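/- (Linearization of the GO divergence) As η → 0, inf_{c>0} { (1/c) log E_P[exp(c(f - E_P f))] + η²/c } = √(Var_P[f]) · √2 · η + O(η²), provided Var_P[f] > 0 and the centered MGF is finite in a neighborhood of 0. Consequently, |E_Q f - E_P f| ≤ √(2 Var_P[f] R(Q||P)) + O(R(Q||P)) as R(Q||P) → 0. -/

import Mathlib

open MeasureTheory ProbabilityTheory Real

/-- Kullback-Leibler divergence R(Q||P) = ∫ log(dQ/dP) dQ (as a real number). -/
noncomputable def klDiv {α : Type*} [MeasurableSpace α] (Q P : Measure α) : ℝ :=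
  ∫ x, Real.log ((Q.rnDeriv P x).toReal) ∂Q

open Filter Topology in
/-- Second order Taylor expansion at `0` of a real analytic function with a double zero there. -/
lemma AnalyticAt.exists_abs_sub_sq_le {K : ℝ → ℝ} {v : ℝ} (hK : AnalyticAt ℝ K 0)
    (h0 : K 0 = 0) (h1 : deriv K 0 = 0) (h2 : iteratedDeriv 2 K 0 = v) :
    ∃ M > 0, ∀ᶠ c in 𝓝 (0 : ℝ), |K c - v / 2 * c ^ 2| ≤ M * |c| ^ 3 := by
  have hsq : AnalyticAt ℝ (fun c : ℝ => v / 2 * c ^ 2) 0 := by fun_prop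
  have hord : ((3 : ℕ) : ℕ∞) ≤ analyticOrderAt (K - fun c : ℝ => v / 2 * c ^ 2) 0 := by
    rw [natCast_le_analyticOrderAt_iff_iteratedDeriv_eq_zero (hK.sub hsq)]
    intro i hi
    rw [iteratedDeriv_sub hK.contDiffAt hsq.contDiffAt, iteratedDeriv_const_mul_field]
    interval_cases i
    · simp [h0]
    · simp [h1]
    · simp [h2]
  obtain ⟨g, hg, hKg⟩ := (natCast_le_analyticOrderAt (hK.sub hsq)).1 hord
  have hbound : ∀ᶠ c in 𝓝 (0 : ℝ), |g c| < |g 0| + 1 :=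
    hg.continuousAt.abs.eventually_lt_const (lt_add_one _)
  refine ⟨|g 0| + 1, by positivity, ?_⟩
  filter_upwards [hKg, hbound] with c hc hb
  simp only [Pi.sub_apply, sub_zero, smul_eq_mul] at hc
  rw [hc, abs_mul, abs_pow, mul_comm]
  gcongr

/-- The slope `cgf X μ c / c` is monotone in `c > 0`. -/
lemma cgf_div_le_cgf_div {α : Type*} [MeasurableSpace α] {P : Measure α} [IsProbabilityMeasure P]
    {X : α → ℝ} {r c : ℝ} (hr : 0 < r) (hrc : r ≤ c)
    (hXr : Integrable (fun x => exp (r * X x)) P) (hXc : Integrable (fun x => exp (c * X x)) P) :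
    cgf X P r / r ≤ cgf X P c / c := by
  have hc : 0 < c := hr.trans_le hrc
  have hp : 1 ≤ c / r := (one_le_div hr).2 hrc
  have hpow : ∀ x, exp (r * X x) ^ (c / r) = exp (c * X x) := fun x => by
    rw [← exp_mul]
    congr 1
    field_simp
  have hjensen := (convexOn_rpow hp).map_integral_le (μ := P) (f := fun x => exp (r * X x))
    (continuous_rpow_const (zero_le_one.trans hp)).continuousOn isClosed_Ici
    (ae_of_all _ fun x => (exp_pos _).le) hXr (by simpa only [Function.comp_def, hpow] using hXc)
  simp only [hpow] at hjensen
  have hpos : 0 < mgf X P r := mgf_pos hXr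
  have hlog := log_le_log (rpow_pos_of_pos hpos _) hjensen
  rw [log_rpow hpos] at hlog
  change c / r * cgf X P r ≤ cgf X P c at hlog
  rw [le_div_iff₀ hc]
  calc cgf X P r / r * c = c / r * cgf X P r := by ring
    _ ≤ _ := hlog

lemma klDiv_nonneg {α : Type*} [MeasurableSpace α] {P Q : Measure α} [IsProbabilityMeasure P]
    [IsProbabilityMeasure Q] (hQP : Q ≪ P) (hint : Integrable (llr Q P) Q) :
    0 ≤ klDiv Q P := by
  have h := InformationTheory.integral_llr_add_sub_measure_univ_nonneg hQP hint
  simpa [klDiv, llr] using h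

/-- The Gibbs variational inequality. -/
lemma integral_le_klDiv_add_log_integral_exp {α : Type*} [MeasurableSpace α] {P Q : Measure α}
    [IsProbabilityMeasure P] [IsProbabilityMeasure Q] {g : α → ℝ} (hQP : Q ≪ P)
    (hint : Integrable (llr Q P) Q) (hgQ : Integrable g Q)
    (hgP : Integrable (fun x => exp (g x)) P) :
    ∫ x, g x ∂Q ≤ klDiv Q P + log (∫ x, exp (g x) ∂P) := by
  have : IsProbabilityMeasure (P.tilted g) := isProbabilityMeasure_tilted hgP
  have h := InformationTheory.integral_llr_add_sub_measure_univ_nonneg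
    (hQP.trans (absolutelyContinuous_tilted hgP)) (integrable_llr_tilted_right hQP hgQ hint hgP)
  rw [integral_llr_tilted_right hQP hgQ hgP hint] at h
  simp only [probReal_univ, add_sub_cancel_right] at h
  have : klDiv Q P = ∫ x, llr Q P x ∂Q := rfl
  linarith

/-- Quadratic control of the cumulant generating function near `0` for a centered variable. -/
lemma exists_abs_cgf_sub_le {α : Type*} [MeasurableSpace α] {P : Measure α}
    [IsProbabilityMeasure P] {f : α → ℝ} (hf : Measurable f) (hfP : Integrable f P)
    (hmgf : ∃ δ > (0 : ℝ), ∀ c : ℝ, |c| < δ →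
      Integrable (fun x => exp (c * (f x - ∫ y, f y ∂P))) P) :
    ∃ M > 0, ∃ r > 0, ∀ c : ℝ, |c| < r →
      Integrable (fun x => exp (c * (f x - ∫ y, f y ∂P))) P ∧
      |cgf (fun x => f x - ∫ y, f y ∂P) P c - variance f P / 2 * c ^ 2| ≤ M * |c| ^ 3 := by
  obtain ⟨δ, hδ, hint⟩ := hmgf
  set X : α → ℝ := fun x => f x - ∫ y, f y ∂P with hX
  have hmem : (0 : ℝ) ∈ interior (integrableExpSet X P) := by
    rw [mem_interior_iff_mem_nhds, Metric.mem_nhds_iff]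
    refine ⟨δ, hδ, fun c hc => hint c ?_⟩
    simpa using hc
  have hderiv : deriv (cgf X P) 0 = 0 := by
    rw [deriv_cgf_zero hmem, hX, integral_sub hfP (integrable_const _)]
    simp
  have hsecond : iteratedDeriv 2 (cgf X P) 0 = variance f P := by
    rw [iteratedDeriv_two_cgf_eq_integral hmem, hderiv, variance_eq_integral hf.aemeasurable]
    simp [hX]
  obtain ⟨M, hM, hev⟩ :=
    (analyticAt_cgf hmem).exists_abs_sub_sq_le cgf_zero hderiv hsecond
  obtain ⟨r, hr, hball⟩ := Metric.eventually_nhds_iff.1 hev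
  refine ⟨M, hM, min r δ, lt_min hr hδ, fun c hc => ⟨hint c (hc.trans_le (min_le_right _ _)), ?_⟩⟩
  exact hball (by simpa using hc.trans_le (min_le_left _ _))

/-- Expansion of `inf_{c > 0} (K c + η ^ 2) / c` for `K c = a ^ 2 / 4 * c ^ 2 + O(c ^ 3)`, when
`K c / c` does not drop below its value at `r` for `c ≥ r`. -/
lemma abs_sInf_sub_le {K : ℝ → ℝ} {S : Set ℝ} {a M r η : ℝ} (ha : 0 < a) (hM : 0 < M)
    (hr : 0 < r) (hMr : M * r ≤ a ^ 2 / 8) (hS : ∀ c, 0 < c → c ≤ r → c ∈ S)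
    (hK : ∀ c, 0 < c → c ≤ r → |K c - a ^ 2 / 4 * c ^ 2| ≤ M * c ^ 3)
    (hslope : ∀ c ∈ S, r ≤ c → K r / r ≤ K c / c) (hη : 0 < η) (hηr : η < a * r / 8) :
    |sInf {y : ℝ | ∃ c : ℝ, 0 < c ∧ c ∈ S ∧ y = (1 / c) * K c + η ^ 2 / c} - a * η|
      ≤ 64 * M / a ^ 2 * η ^ 2 := by
  have hlow : ∀ c, 0 < c → c ≤ r → a ^ 2 / 4 * c - M * c ^ 2 ≤ K c / c := fun c hc hcr => by
    rw [le_div_iff₀ hc]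
    linarith [(abs_le.1 (hK c hc hcr)).1]
  have hC : 0 ≤ 64 * M / a ^ 2 * η ^ 2 := by positivity
  have hbound : ∀ y ∈ {y : ℝ | ∃ c : ℝ, 0 < c ∧ c ∈ S ∧ y = (1 / c) * K c + η ^ 2 / c},
      a * η - 64 * M / a ^ 2 * η ^ 2 ≤ y := by
    rintro y ⟨c, hc, hcS, rfl⟩
    rw [one_div_mul_eq_div]
    have hpos : 0 < η ^ 2 / c := by positivity
    rcases le_total r c with hrc | hcr
    · have h1 := hslope c hcS hrc
      have h2 := hlow r hr le_rfl
      nlinarith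
    · have h1 := hlow c hc hcr
      rcases le_total c (8 * η / a) with hcη | hcη
      · have hamgm : a * η ≤ a ^ 2 / 4 * c + η ^ 2 / c := by
          have : a ^ 2 / 4 * c + η ^ 2 / c - a * η = (a * c / 2 - η) ^ 2 / c := by
            field_simp
            ring
          have : 0 ≤ (a * c / 2 - η) ^ 2 / c := by positivity
          linarith
        have hcube : M * c ^ 2 ≤ 64 * M / a ^ 2 * η ^ 2 := by
          calc M * c ^ 2 ≤ M * (8 * η / a) ^ 2 := by gcongr
            _ = _ := by ring
        linarith
      · have h2 : 8 * η ≤ c * a := (div_le_iff₀ ha).1 hcη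
        have h3 : M * c ^ 2 ≤ a ^ 2 / 8 * c := by
          calc M * c ^ 2 = M * c * c := by ring
            _ ≤ M * r * c := by gcongr
            _ ≤ _ := by gcongr
        nlinarith
  have hη' : 2 * η / a ≤ r := by
    rw [div_le_iff₀ ha]
    linarith
  have hc : 0 < 2 * η / a := by positivity
  have hmem : (1 / (2 * η / a)) * K (2 * η / a) + η ^ 2 / (2 * η / a) ∈
      {y : ℝ | ∃ c : ℝ, 0 < c ∧ c ∈ S ∧ y = (1 / c) * K c + η ^ 2 / c} :=
    ⟨_, hc, hS _ hc hη', rfl⟩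
  have hup : (1 / (2 * η / a)) * K (2 * η / a) + η ^ 2 / (2 * η / a)
      ≤ a * η + 64 * M / a ^ 2 * η ^ 2 := by
    have h1 : K (2 * η / a) ≤ a ^ 2 / 4 * (2 * η / a) ^ 2 + M * (2 * η / a) ^ 3 := by
      linarith [(abs_le.1 (hK _ hc hη')).2]
    calc _ ≤ (1 / (2 * η / a)) * (a ^ 2 / 4 * (2 * η / a) ^ 2 + M * (2 * η / a) ^ 3)
          + η ^ 2 / (2 * η / a) := by gcongr
      _ = a * η + 4 * M / a ^ 2 * η ^ 2 := by
        field_simp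
        ring
      _ ≤ _ := by
        gcongr
        norm_num
  rw [abs_le]
  constructor
  · linarith [le_csInf ⟨_, hmem⟩ hbound]
  · linarith [csInf_le ⟨_, hbound⟩ hmem]

/-- Optimizing `c * D ≤ R + a ^ 2 / 4 * c ^ 2 + M * c ^ 3` over `c`. -/
lemma le_mul_sqrt_add_of_forall_mul_le {a M r D R : ℝ} (ha : 0 < a) (hr : 0 < r)
    (hR : 0 ≤ R) (hRr : R < (a * r / 2) ^ 2)
    (h : ∀ c, 0 < c → c ≤ r → c * D ≤ R + a ^ 2 / 4 * c ^ 2 + M * c ^ 3) :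
    D ≤ a * √R + 4 * M / a ^ 2 * R := by
  rcases hR.eq_or_lt with rfl | hR
  · have hlim : Filter.Tendsto (fun c : ℝ => a ^ 2 / 4 * c + M * c ^ 2)
        (nhdsWithin 0 (Set.Ioi 0)) (nhds 0) :=
      ((by fun_prop : Continuous fun c : ℝ => a ^ 2 / 4 * c + M * c ^ 2).tendsto' 0 0
        (by simp)).mono_left nhdsWithin_le_nhds
    have hD : D ≤ 0 := by
      refine ge_of_tendsto hlim ?_
      filter_upwards [Ioc_mem_nhdsGT hr] with c hc
      refine le_of_mul_le_mul_left ?_ hc.1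
      linarith [h c hc.1 hc.2]
    simpa using hD
  · have hs : 0 < √R := sqrt_pos.2 hR
    have hsr : √R < a * r / 2 := (sqrt_lt' (by positivity)).2 hRr
    have hsq : √R ^ 2 = R := sq_sqrt hR.le
    have hc : 0 < 2 * √R / a := by positivity
    refine le_of_mul_le_mul_left ((h _ hc ?_).trans_eq ?_) hc
    · rw [div_le_iff₀ ha]
      linarith
    · generalize √R = s at *
      subst hsq
      field_simp
      ring

/-- linearization of the goal-oriented divergence as η → 0,
and the resulting linearized model bias bound. -/
theorem go_divergence_linearization
    {α : Type*} [MeasurableSpace α] (P : Measure α) [IsProbabilityMeasure P]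
    (f : α → ℝ) (hf : Measurable f) (hfP : Integrable f P)
    (hvar : 0 < variance f P)
    (hmgf : ∃ δ > (0:ℝ), ∀ c : ℝ, |c| < δ →
      Integrable (fun x => Real.exp (c * (f x - ∫ y, f y ∂P))) P) :
    (∃ C > (0:ℝ), ∃ δ > (0:ℝ), ∀ η : ℝ, 0 < η → η < δ →
      |sInf {y : ℝ | ∃ c : ℝ, 0 < c ∧
          Integrable (fun x => Real.exp (c * (f x - ∫ z, f z ∂P))) P ∧
          y = (1/c) * Real.log (∫ x, Real.exp (c * (f x - ∫ z, f z ∂P)) ∂P)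
              + η^2 / c}
        - Real.sqrt (variance f P) * Real.sqrt 2 * η| ≤ C * η^2) ∧
    (∃ C > (0:ℝ), ∃ δ > (0:ℝ), ∀ Q : Measure α, IsProbabilityMeasure Q → Q ≪ P →
      Integrable f Q →
      Integrable (fun x => Real.log ((Q.rnDeriv P x).toReal)) Q →
      klDiv Q P < δ →
      |(∫ x, f x ∂Q) - ∫ y, f y ∂P| ≤
        Real.sqrt (2 * variance f P * klDiv Q P) + C * klDiv Q P) := by
  obtain ⟨M, hM, r₀, hr₀, hcgf⟩ := exists_abs_cgf_sub_le hf hfP hmgf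
  have ha : 0 < √(variance f P) * √2 := by positivity
  have ha2 : (√(variance f P) * √2) ^ 2 = 2 * variance f P := by
    rw [mul_pow, sq_sqrt hvar.le, sq_sqrt zero_le_two, mul_comm]
  generalize √(variance f P) * √2 = a at ha ha2
  set X : α → ℝ := fun x => f x - ∫ y, f y ∂P with hX
  obtain ⟨r, hr, hrr₀, hMr⟩ : ∃ r > 0, r < r₀ ∧ M * r ≤ a ^ 2 / 8 := by
    refine ⟨min (r₀ / 2) (a ^ 2 / 8 / M), by positivity,
      (min_le_left _ _).trans_lt (half_lt_self hr₀), ?_⟩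
    rw [mul_comm, ← le_div_iff₀ hM]
    exact min_le_right _ _
  have hK : ∀ c : ℝ, |c| ≤ r → |cgf X P c - a ^ 2 / 4 * c ^ 2| ≤ M * |c| ^ 3 := fun c hc => by
    have := (hcgf c (hc.trans_lt hrr₀)).2
    rwa [show variance f P / 2 = a ^ 2 / 4 by rw [ha2]; ring] at this
  have hint : ∀ c : ℝ, |c| ≤ r → Integrable (fun x => exp (c * X x)) P := fun c hc =>
    (hcgf c (hc.trans_lt hrr₀)).1
  constructor
  · refine ⟨64 * M / a ^ 2, by positivity, a * r / 8, by positivity, fun η hη hηr => ?_⟩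
    exact abs_sInf_sub_le (K := cgf X P) (S := integrableExpSet X P) ha hM hr hMr
      (fun c hc hcr => hint c (by rwa [abs_of_pos hc]))
      (fun c hc hcr => by simpa only [abs_of_pos hc] using hK c (by rwa [abs_of_pos hc]))
      (fun c hc hrc => cgf_div_le_cgf_div hr hrc (hint r (abs_of_pos hr).le) hc) hη hηr
  · refine ⟨4 * M / a ^ 2, by positivity, (a * r / 2) ^ 2, by positivity,
      fun Q _ hQP hfQ hllr hRr => ?_⟩
    have hXQ : Integrable X Q := hfQ.sub (integrable_const _)
    have hmean : (∫ x, f x ∂Q) - ∫ y, f y ∂P = ∫ x, X x ∂Q := by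
      rw [hX, integral_sub hfQ (integrable_const _)]
      simp
    have hgibbs : ∀ c : ℝ, |c| ≤ r →
        c * ∫ x, X x ∂Q ≤ klDiv Q P + a ^ 2 / 4 * c ^ 2 + M * |c| ^ 3 := fun c hc => by
      have h := integral_le_klDiv_add_log_integral_exp hQP hllr (hXQ.const_mul c) (hint c hc)
      rw [integral_const_mul] at h
      change _ ≤ _ + cgf X P c at h
      linarith [(abs_le.1 (hK c hc)).2]
    have hsqrt : √(2 * variance f P * klDiv Q P) = a * √(klDiv Q P) := by
      rw [← ha2, sqrt_mul (sq_nonneg a), sqrt_sq ha.le]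
    rw [hmean, hsqrt]
    refine le_mul_sqrt_add_of_forall_mul_le ha hr (klDiv_nonneg hQP hllr) hRr
      fun c hc hcr => ?_
    have hpos := hgibbs c (by rwa [abs_of_pos hc])
    have hneg := hgibbs (-c) (by rwa [abs_neg, abs_of_pos hc])
    rw [abs_neg, neg_sq, neg_mul] at hneg
    rw [abs_of_pos hc] at hpos hneg
    rcases abs_cases (∫ x, X x ∂Q) with ⟨h, _⟩ | ⟨h, _⟩ <;> rw [h] <;> linarith
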